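/- arXiv:1602.01189 — 9 statements merged into one kernel-verified Lean document; each statement's English description precedes it below -/
import Mathlib

section
/- Let n ≥ 1 and m ≥ 1, and let A_1, …, A_m be n×n complex matrices satisfying A_i A_j = −A_j A_i for all 1 ≤ i, j ≤ m (in particular, taking i = j, each A_i is step-2 nilpotent: A_i² = 0). Then the common kernel is nonzero: there exists a nonzero vector v ∈ ℂⁿ such that A_i v = 0 for every i = 1, …, m. -/
/-- A finite family of pairwise anti-commuting square-zero matrices over a commutative ring
annihilates a common nonzero vector. -/
theorem Matrix.exists_ne_zero_forall_mulVec_eq_zero_of_anticommute {R ι κ : Type*} [CommRing R]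
    [Nontrivial R] [Fintype κ] [Nonempty κ] (A : ι → Matrix κ κ R)
    (hsq : ∀ i, A i * A i = 0) (hA : ∀ i j, A i * A j = -(A j * A i)) (s : Finset ι) :
    ∃ v : κ → R, v ≠ 0 ∧ ∀ i ∈ s, (A i).mulVec v = 0 := by
  classical
  induction s using Finset.induction_on with
  | empty => exact ⟨1, one_ne_zero, by simp⟩
  | insert a s _ ih =>
    obtain ⟨v, hv, hs⟩ := ih
    by_cases ha : (A a).mulVec v = 0
    · exact ⟨v, hv, by simpa [ha] using hs⟩
    · refine ⟨(A a).mulVec v, ha, fun i hi => ?_⟩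
      rcases Finset.mem_insert.mp hi with rfl | hi
      · rw [Matrix.mulVec_mulVec, hsq, Matrix.zero_mulVec]
      · rw [Matrix.mulVec_mulVec, hA, Matrix.neg_mulVec, ← Matrix.mulVec_mulVec, hs i hi,
          Matrix.mulVec_zero, neg_zero]

/-- Any finite family of pairwise anti-commuting `n × n` complex matrices
(in particular each is step-2 nilpotent) has a common nonzero kernel vector. -/
theorem common_kernel_of_anticommuting_family (n m : ℕ) (hn : 1 ≤ n) (hm : 1 ≤ m)
    (A : Fin m → Matrix (Fin n) (Fin n) ℂ)
    (hA : ∀ i j : Fin m, A i * A j = -(A j * A i)) :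
    ∃ v : Fin n → ℂ, v ≠ 0 ∧ ∀ i : Fin m, (A i).mulVec v = 0 := by
  have : Nonempty (Fin n) := ⟨⟨0, hn⟩⟩
  obtain ⟨v, hv, h⟩ := Matrix.exists_ne_zero_forall_mulVec_eq_zero_of_anticommute A
    (fun i => Matrix.ext fun k l => self_eq_neg.mp (congrFun₂ (hA i i) k l)) hA Finset.univ
  exact ⟨v, hv, fun i => h i (Finset.mem_univ i)⟩
end

section
/- Let A and B be 2×2 complex matrices with A ≠ 0, A² = 0, B² = 0, and AB = −BA. Then B is a scalar multiple of A: there exists c ∈ ℂ with B = c·A. -/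
/-- A `2 × 2` matrix squaring to zero over a domain is traceless, with vanishing determinant. -/
lemma Matrix.entries_of_mul_self_eq_zero {R : Type*} [CommRing R] [IsDomain R]
    {M : Matrix (Fin 2) (Fin 2) R} (hM : M * M = 0) :
    M 1 1 = -M 0 0 ∧ M 0 0 ^ 2 + M 0 1 * M 1 0 = 0 := by
  have h00 := congrFun₂ hM 0 0
  have h01 := congrFun₂ hM 0 1
  have h10 := congrFun₂ hM 1 0
  have h11 := congrFun₂ hM 1 1
  simp only [Matrix.mul_apply, Fin.sum_univ_two, Matrix.zero_apply] at h00 h01 h10 h11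
  refine ⟨?_, by linear_combination h00⟩
  by_contra htr
  have htr' : M 0 0 + M 1 1 ≠ 0 := fun h => htr (by linear_combination h)
  have hb : M 0 1 = 0 :=
    (mul_eq_zero.mp (by linear_combination h01 : M 0 1 * (M 0 0 + M 1 1) = 0)).resolve_right htr'
  have ha : M 0 0 = 0 := mul_self_eq_zero.mp (by linear_combination h00 - M 1 0 * hb)
  have hd : M 1 1 = 0 := mul_self_eq_zero.mp (by linear_combination h11 - M 1 0 * hb)
  exact htr (by rw [ha, hd, neg_zero])

/-- If `A ≠ 0`, `A² = 0`, `B² = 0` and `AB = -BA` for `2 × 2` complex matrices,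
then `B` is a scalar multiple of `A`. -/
theorem smul_of_anticommuting_nilpotent_two_by_two
    (A B : Matrix (Fin 2) (Fin 2) ℂ) (hA : A ≠ 0)
    (hA2 : A * A = 0) (hB2 : B * B = 0) (hAB : A * B = -(B * A)) :
    ∃ c : ℂ, B = c • A := by
  obtain ⟨hAtr, hAdet⟩ := Matrix.entries_of_mul_self_eq_zero hA2
  obtain ⟨hBtr, hBdet⟩ := Matrix.entries_of_mul_self_eq_zero hB2
  have h := congrFun₂ hAB 0 0
  simp only [Matrix.mul_apply, Fin.sum_univ_two, Matrix.neg_apply] at h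
  have h₁ : A 0 0 * B 0 1 - A 0 1 * B 0 0 = 0 := by
    refine pow_eq_zero_iff two_ne_zero |>.mp ?_
    linear_combination B 0 1 ^ 2 * hAdet + A 0 1 ^ 2 * hBdet - A 0 1 * B 0 1 * h
  have h₂ : A 0 0 * B 1 0 - A 1 0 * B 0 0 = 0 := by
    refine pow_eq_zero_iff two_ne_zero |>.mp ?_
    linear_combination B 1 0 ^ 2 * hAdet + A 1 0 ^ 2 * hBdet - A 1 0 * B 1 0 * h
  have h₃ : A 0 1 * B 1 0 - A 1 0 * B 0 1 = 0 := by
    refine pow_eq_zero_iff two_ne_zero |>.mp ?_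
    linear_combination (A 0 1 * B 1 0 + B 0 1 * A 1 0 - 2 * A 0 0 * B 0 0) * h
      - 4 * B 0 1 * B 1 0 * hAdet + 4 * A 0 0 ^ 2 * hBdet
  by_cases hb : A 0 1 = 0
  · by_cases hc : A 1 0 = 0
    · have ha : A 0 0 = 0 := by simpa [hb] using hAdet
      refine absurd ?_ hA
      ext i j
      fin_cases i <;> fin_cases j <;> simp [ha, hb, hc, hAtr]
    · refine ⟨B 1 0 / A 1 0, ?_⟩
      ext i j
      fin_cases i <;> fin_cases j <;> simp [hAtr, hBtr] <;> field_simp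
      · linear_combination -h₂
      · linear_combination -h₃
      · linear_combination -h₂
  · refine ⟨B 0 1 / A 0 1, ?_⟩
    ext i j
    fin_cases i <;> fin_cases j <;> simp [hAtr, hBtr] <;> field_simp
    · linear_combination -h₁
    · linear_combination h₃
    · linear_combination -h₁
end

section
/- For any n×n complex matrix X there exists a map f : ℂ → M_n(ℂ), smooth as a map of real manifolds (C^∞ over ℝ), such that f(0) = I, f(z) is a unitary matrix for every z ∈ ℂ, and the Wirtinger derivative of f at 0 equals X: (1/2)·(Df(0)(1) − i·Df(0)(i)) = X, where Df(0) denotes the real Fréchet derivative of f at 0. -/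
open scoped Matrix
attribute [local instance] Matrix.normedAddCommGroup Matrix.normedSpace

namespace NormedSpace

theorem contDiff_exp_complex {A : Type*} [NormedRing A] [NormedAlgebra ℂ A] [CompleteSpace A]
    {k : WithTop ℕ∞} : ContDiff ℂ k (exp : A → A) :=
  contDiff_iff_contDiffAt.2 fun x => (exp_analytic (𝕂 := ℂ) x).contDiffAt

end NormedSpace

/-- The real-linear map `z ↦ z T - conj z T*`, with values in the skew-adjoint elements. -/
noncomputable def skewAdjointLine {A : Type*} [NormedRing A] [NormedAlgebra ℂ A] [Star A]
    (T : A) : ℂ →L[ℝ] A :=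
  (ContinuousLinearMap.id ℝ ℂ).smulRight T -
    (Complex.conjCLE : ℂ →L[ℝ] ℂ).smulRight (star T)

theorem skewAdjointLine_apply {A : Type*} [NormedRing A] [NormedAlgebra ℂ A] [Star A]
    (T : A) (z : ℂ) :
    skewAdjointLine T z = z • T - (starRingEnd ℂ) z • star T := by
  simp [skewAdjointLine]

theorem skewAdjointLine_mem {A : Type*} [NormedRing A] [NormedAlgebra ℂ A] [StarRing A]
    [StarModule ℂ A] (T : A) (z : ℂ) : skewAdjointLine T z ∈ skewAdjoint A := by
  simp [skewAdjoint.mem_iff, skewAdjointLine_apply]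

section ExpSkewAdjointLine

variable {A : Type*} [NormedRing A] [NormedAlgebra ℂ A] [CompleteSpace A]

theorem contDiff_exp_skewAdjointLine [Star A] (T : A) {k : WithTop ℕ∞} :
    ContDiff ℝ k (fun z => NormedSpace.exp (skewAdjointLine T z)) :=
  (NormedSpace.contDiff_exp_complex.restrict_scalars ℝ).comp (skewAdjointLine T).contDiff

theorem hasFDerivAt_exp_skewAdjointLine [Star A] (T : A) :
    HasFDerivAt (fun z => NormedSpace.exp (skewAdjointLine T z)) (skewAdjointLine T) 0 := by
  have hexp : HasFDerivAt NormedSpace.exp (ContinuousLinearMap.id ℝ A)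
      (skewAdjointLine T 0) := by
    rw [map_zero]
    exact hasFDerivAt_exp_zero (𝕂 := ℝ)
  exact hexp.comp 0 (skewAdjointLine T).hasFDerivAt

theorem exp_skewAdjointLine_mem_unitary [StarRing A] [StarModule ℂ A] [ContinuousStar A]
    (T : A) (z : ℂ) : NormedSpace.exp (skewAdjointLine T z) ∈ unitary A :=
  let _ : NormedAlgebra ℚ A := NormedAlgebra.restrictScalars ℚ ℂ A
  NormedSpace.exp_mem_unitary_of_mem_skewAdjoint (skewAdjointLine_mem T z)

/-- A star-algebra isomorphism from a finite-dimensional Banach star-algebra transports the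
exponential of `skewAdjointLine` to a unitary-valued map. -/
theorem exists_smooth_unitary_of_starAlgEquiv [StarRing A] [StarModule ℂ A] [ContinuousStar A]
    [FiniteDimensional ℂ A] {n : ℕ} (e : A ≃⋆ₐ[ℂ] Matrix (Fin n) (Fin n) ℂ)
    (X : Matrix (Fin n) (Fin n) ℂ) :
    ∃ f : ℂ → Matrix (Fin n) (Fin n) ℂ,
      ContDiff ℝ (⊤ : ℕ∞) f ∧
      f 0 = 1 ∧
      (∀ z : ℂ, f z * (f z)ᴴ = 1) ∧
      (1 / 2 : ℂ) • (fderiv ℝ f 0 1 - Complex.I • fderiv ℝ f 0 Complex.I) = X := by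
  let L := (e.toAlgEquiv.toLinearMap.toContinuousLinearMap).restrictScalars ℝ
  have hL (S : A) : L S = e S := rfl
  let T := e.symm X
  have hT : e T = X := e.apply_symm_apply X
  refine ⟨fun z => L (NormedSpace.exp (skewAdjointLine T z)),
    L.contDiff.comp (contDiff_exp_skewAdjointLine T), ?_, fun z => ?_, ?_⟩
  · simp [hL]
  · simp only [hL, ← Matrix.star_eq_conjTranspose]
    rw [← map_star, ← map_mul,
      Unitary.mul_star_self_of_mem (exp_skewAdjointLine_mem_unitary T z), map_one]
  · have hderiv (v : ℂ) : fderiv ℝ (fun z => L (NormedSpace.exp (skewAdjointLine T z))) 0 v =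
        e (skewAdjointLine T v) :=
      DFunLike.congr_fun
        (L.hasFDerivAt.comp 0 (hasFDerivAt_exp_skewAdjointLine T)).fderiv v
    have hwirtinger : (1 / 2 : ℂ) • (e (skewAdjointLine T 1) -
        Complex.I • e (skewAdjointLine T Complex.I)) = X := by
      simp only [skewAdjointLine_apply, map_sub, map_neg, map_smul, map_star, hT, Complex.conj_I,
        map_one, smul_sub, smul_smul, neg_smul, smul_neg, Complex.I_mul_I]
      module
    rwa [← hderiv, ← hderiv] at hwirtinger

end ExpSkewAdjointLine

/-- For any `n × n` complex matrix `X`, there is a real-smooth map `f` from `ℂ`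
into the unitary matrices with `f 0 = I` whose Wirtinger derivative
`∂f/∂z` at `0` equals `X`. -/
theorem exists_smooth_unitary_with_prescribed_wirtinger_deriv
    (n : ℕ) (X : Matrix (Fin n) (Fin n) ℂ) :
    ∃ f : ℂ → Matrix (Fin n) (Fin n) ℂ,
      ContDiff ℝ (⊤ : ℕ∞) f ∧
      f 0 = 1 ∧
      (∀ z : ℂ, f z * (f z)ᴴ = 1) ∧
      (1 / 2 : ℂ) • (fderiv ℝ f 0 1 - Complex.I • fderiv ℝ f 0 Complex.I) = X :=
  exists_smooth_unitary_of_starAlgEquiv (Matrix.toEuclideanCLM (𝕜 := ℂ) (n := Fin n)).symm X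
end

section
/- Given m ≥ 1 and n×n complex matrices X_1, …, X_m, there exists a map A : ℂ^m → M_n(ℂ), smooth as a map of real manifolds (C^∞ over ℝ), such that A(0) = I, A(w) is a unitary matrix for every w ∈ ℂ^m, and for each i = 1, …, m the i-th Wirtinger derivative of A at 0 equals X_i: (1/2)·(DA(0)(e_i) − i·DA(0)(i·e_i)) = X_i, where e_i is the i-th standard basis vector of ℂ^m and DA(0) denotes the real Fréchet derivative of A at 0. -/
open scoped Matrix

attribute [local instance] Matrix.normedAddCommGroup Matrix.normedSpace

open NormedSpace
open scoped ComplexOrder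

/-- The real-linear map `w ↦ ∑ i, (wᵢ • Xᵢ - (wᵢ • Xᵢ)⋆)`. -/
noncomputable def skewPart {ι 𝔸 : Type*} [Fintype ι] [CStarAlgebra 𝔸] (X : ι → 𝔸) :
    (ι → ℂ) →L[ℝ] 𝔸 :=
  LinearMap.toContinuousLinearMap
    { toFun := fun w => ∑ i, (w i • X i - star (w i • X i))
      map_add' := fun v w => by
        rw [← Finset.sum_add_distrib]
        refine Finset.sum_congr rfl fun i _ => ?_
        rw [Pi.add_apply, add_smul, star_add]
        abel
      map_smul' := fun r w => by
        rw [RingHom.id_apply, Finset.smul_sum]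
        refine Finset.sum_congr rfl fun i _ => ?_
        rw [Pi.smul_apply, smul_assoc, star_smul, star_trivial, smul_sub] }

section skewPart

variable {ι 𝔸 : Type*} [Fintype ι] [CStarAlgebra 𝔸] (X : ι → 𝔸)

theorem skewPart_apply (w : ι → ℂ) :
    skewPart X w = ∑ i, (w i • X i - star (w i • X i)) := rfl

theorem skewPart_mem_skewAdjoint (w : ι → ℂ) : skewPart X w ∈ skewAdjoint 𝔸 := by
  rw [skewPart_apply]
  refine sum_mem fun i _ => skewAdjoint.mem_iff.mpr ?_
  rw [star_sub, star_star, neg_sub]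

theorem skewPart_single [DecidableEq ι] (i : ι) (z : ℂ) :
    skewPart X (Pi.single i z) = z • X i - star (z • X i) := by
  rw [skewPart_apply, Finset.sum_eq_single i]
  · simp
  · intro j _ hj
    simp [Pi.single_eq_of_ne hj]
  · simp

theorem wirtinger_skewPart [DecidableEq ι] (i : ι) :
    (1 / 2 : ℂ) • (skewPart X (Pi.single i 1)
      - Complex.I • skewPart X (Pi.single i Complex.I)) = X i := by
  rw [skewPart_single, skewPart_single]
  simp only [star_smul, one_smul, smul_sub, RCLike.star_def, Complex.conj_I]
  match_scalars <;> linear_combination (-1 / 2 : ℂ) * Complex.I_mul_I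

end skewPart

theorem contDiff_real_exp {𝔸 : Type*} [CStarAlgebra 𝔸] {k : WithTop ℕ∞} :
    ContDiff ℝ k (exp : 𝔸 → 𝔸) :=
  ContDiff.restrict_scalars ℝ <| contDiff_iff_contDiffAt.mpr fun x =>
    (exp_analytic (𝕂 := ℂ) x).contDiffAt

theorem exp_mem_unitary {𝔸 : Type*} [CStarAlgebra 𝔸] {x : 𝔸} (hx : x ∈ skewAdjoint 𝔸) :
    exp x ∈ unitary 𝔸 :=
  letI : NormedAlgebra ℚ 𝔸 := NormedAlgebra.restrictScalars ℚ ℂ 𝔸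
  exp_mem_unitary_of_mem_skewAdjoint hx

theorem hasFDerivAt_exp_skewPart {ι 𝔸 : Type*} [Fintype ι] [CStarAlgebra 𝔸] (X : ι → 𝔸) :
    HasFDerivAt (fun w => exp (skewPart X w)) (skewPart X) 0 := by
  have h : HasFDerivAt (exp : 𝔸 → 𝔸) (1 : 𝔸 →L[ℝ] 𝔸) (skewPart X 0) := by
    rw [map_zero]
    exact hasFDerivAt_exp_zero
  exact h.comp 0 (skewPart X).hasFDerivAt

/-- The inverse of `CStarMatrix.ofMatrix` as a continuous linear equivalence for the entrywise norm. -/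
noncomputable def cstarMatrixEquivMatrix (n : ℕ) :
    CStarMatrix (Fin n) (Fin n) ℂ ≃L[ℂ] Matrix (Fin n) (Fin n) ℂ where
  toLinearEquiv := (CStarMatrix.ofMatrixₗ (R := ℂ)).symm
  continuous_toFun := continuous_id
  continuous_invFun := continuous_id

/-- For any `n × n` complex matrices `X 1, …, X m`, there is a real-smooth map `A`
from `ℂ^m` into the unitary matrices with `A 0 = I` whose `i`-th Wirtinger
derivative `∂A/∂wᵢ` at `0` equals `X i` for every `i`. -/
theorem exists_smooth_unitary_with_prescribed_wirtinger_derivs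
    (n m : ℕ) (hm : 1 ≤ m) (X : Fin m → Matrix (Fin n) (Fin n) ℂ) :
    ∃ A : (Fin m → ℂ) → Matrix (Fin n) (Fin n) ℂ,
      ContDiff ℝ (⊤ : ℕ∞) A ∧
      A 0 = 1 ∧
      (∀ w : Fin m → ℂ, A w * (A w)ᴴ = 1) ∧
      (∀ i : Fin m,
        (1 / 2 : ℂ) • (fderiv ℝ A 0 (Pi.single i 1)
          - Complex.I • fderiv ℝ A 0 (Pi.single i Complex.I)) = X i) := by
  let e : CStarMatrix (Fin n) (Fin n) ℂ ≃L[ℝ] Matrix (Fin n) (Fin n) ℂ :=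
    (cstarMatrixEquivMatrix n).restrictScalars ℝ
  let Y : Fin m → CStarMatrix (Fin n) (Fin n) ℂ := fun i => CStarMatrix.ofMatrix (X i)
  have hd : HasFDerivAt (fun w => e (exp (skewPart Y w)))
      ((e : CStarMatrix (Fin n) (Fin n) ℂ →L[ℝ] Matrix (Fin n) (Fin n) ℂ).comp (skewPart Y)) 0 :=
    e.hasFDerivAt.comp 0 (hasFDerivAt_exp_skewPart Y)
  refine ⟨fun w => e (exp (skewPart Y w)),
    e.contDiff.comp (contDiff_real_exp.comp (skewPart Y).contDiff), ?_, fun w => ?_, fun i => ?_⟩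
  · simp only [map_zero, exp_zero]
    rfl
  · exact Unitary.mul_star_self_of_mem (exp_mem_unitary (skewPart_mem_skewAdjoint Y w))
  · rw [hd.fderiv]
    exact congrArg (cstarMatrixEquivMatrix n) (wirtinger_skewPart Y i)
end

section
/- Let n ≥ 1 and let T^k_{ij} (1 ≤ i, j, k ≤ n) be complex numbers with T^k_{ij} = −T^k_{ji} for all i, j, k. Suppose that for all indices i, j, k, l one has ∑_{r=1}^n T^r_{ik}·conj(T^r_{jl}) = ∑_{r=1}^n ( T^j_{rk}·conj(T^i_{rl}) + T^l_{ri}·conj(T^k_{rj}) ). Then T^k_{ij} = 0 for all i, j, k. -/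
open Finset
open scoped ComplexConjugate

/-- If an array `T k i j` (modelling torsion coefficients `T^k_{ij}`), antisymmetric
in its lower indices, satisfies the quadratic identity forced by `R = Rʰ`, then it
vanishes identically. -/
theorem torsion_vanishes_of_R_eq_Rh (n : ℕ) (hn : 1 ≤ n)
    (T : Fin n → Fin n → Fin n → ℂ)
    (hanti : ∀ i j k : Fin n, T k i j = -T k j i)
    (hmain : ∀ i j k l : Fin n,
      ∑ r, T r i k * conj (T r j l) =
        ∑ r, (T j r k * conj (T i r l) + T l r i * conj (T k r j))) :
    ∀ i j k : Fin n, T k i j = 0 := by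
  have hdiag : ∀ i k, ∑ r, ‖T r i k‖ ^ 2 = ∑ r, (‖T i r k‖ ^ 2 + ‖T k r i‖ ^ 2) := by
    intro i k
    have h := hmain i i k k
    simp only [Complex.mul_conj'] at h
    exact_mod_cast h
  have hsum : ∑ i, ∑ k, ∑ r, ‖T r i k‖ ^ 2 =
      ∑ i, ∑ k, ∑ r, (‖T i r k‖ ^ 2 + ‖T k r i‖ ^ 2) :=
    sum_congr rfl fun i _ => sum_congr rfl fun k _ => hdiag i k
  simp only [sum_add_distrib] at hsum
  have hleft : ∑ i, ∑ k, ∑ r, ‖T r i k‖ ^ 2 = ∑ k, ∑ i, ∑ j, ‖T k i j‖ ^ 2 := by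
    rw [sum_congr rfl fun i _ => sum_comm, sum_comm]
  have hfst : ∑ i, ∑ k, ∑ r, ‖T i r k‖ ^ 2 = ∑ k, ∑ i, ∑ j, ‖T k i j‖ ^ 2 :=
    sum_congr rfl fun i _ => sum_comm
  have hsnd : ∑ i, ∑ k, ∑ r, ‖T k r i‖ ^ 2 = ∑ k, ∑ i, ∑ j, ‖T k i j‖ ^ 2 := by
    rw [sum_comm]
    exact sum_congr rfl fun k _ => sum_comm
  have hzero : ∑ k, ∑ i, ∑ j, ‖T k i j‖ ^ 2 = 0 := by linarith
  intro i j k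
  have hk := (sum_eq_zero_iff_of_nonneg fun k _ => by positivity).1 hzero k (mem_univ k)
  have hi := (sum_eq_zero_iff_of_nonneg fun i _ => by positivity).1 hk i (mem_univ i)
  have hj := (sum_eq_zero_iff_of_nonneg fun j _ => by positivity).1 hi j (mem_univ j)
  simpa using hj
end

section
/- Let n ≥ 1 and let T^k_{ij} (1 ≤ i, j, k ≤ n) be complex numbers with T^k_{ij} = −T^k_{ji} for all i, j, k. Suppose that for all indices i, j, k, l one has 2·∑_{r=1}^n T^r_{ij}·conj(T^r_{kl}) = ∑_{r=1}^n ( T^l_{ri}·conj(T^j_{rk}) + T^k_{rj}·conj(T^i_{rl}) − T^k_{ri}·conj(T^j_{rl}) − T^l_{rj}·conj(T^i_{rk}) ). Then the trace vanishes: ∑_{i=1}^n T^i_{ik} = 0 for every k. -/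
open Finset
open scoped ComplexConjugate

/-- If an array `T k i j` (modelling torsion coefficients `T^k_{ij}`), antisymmetric
in its lower indices, satisfies identity (25) of the paper (torsion of a metric that
is both Kähler-like and G-Kähler-like), then its trace vanishes, i.e. the metric is
balanced. -/
theorem balanced_of_kahler_like_and_G_kahler_like (n : ℕ) (hn : 1 ≤ n)
    (T : Fin n → Fin n → Fin n → ℂ)
    (hanti : ∀ i j k : Fin n, T k i j = -T k j i)
    (hmain : ∀ i j k l : Fin n,
      2 * ∑ r, T r i j * conj (T r k l) =
        ∑ r, (T l r i * conj (T j r k) + T k r j * conj (T i r l)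
          - T k r i * conj (T j r l) - T l r j * conj (T i r k))) :
    ∀ k : Fin n, ∑ i, T i i k = 0 := by
  have trace_neg (r : Fin n) : ∑ i, T i r i = -∑ i, T i i r := by
    rw [← sum_neg_distrib]
    exact sum_congr rfl fun i _ => hanti r i i
  have hsum := sum_congr (rfl : (univ : Finset (Fin n)) = univ) fun i _ =>
    sum_congr (rfl : (univ : Finset (Fin n)) = univ) fun j _ => hmain i j i j
  simp only [sum_sub_distrib, sum_add_distrib, ← mul_sum] at hsum
  have norm_fst : ∑ i, ∑ j, ∑ r, T j r i * conj (T j r i) =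
      ∑ i, ∑ j, ∑ r, T r i j * conj (T r i j) := by
    rw [sum_congr rfl fun i _ => sum_comm, sum_comm]
  have norm_snd : ∑ i, ∑ j, ∑ r, T i r j * conj (T i r j) =
      ∑ i, ∑ j, ∑ r, T r i j * conj (T r i j) := by
    rw [sum_comm]
    exact norm_fst
  have trace_fst : ∑ i, ∑ j, ∑ r, T i r i * conj (T j r j) =
      ∑ r, (∑ i, T i i r) * conj (∑ i, T i i r) := by
    rw [sum_congr rfl fun i _ => sum_comm, sum_comm]
    refine sum_congr rfl fun r _ => ?_
    rw [← neg_mul_neg, ← map_neg, ← trace_neg, map_sum, sum_mul_sum]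
  have trace_snd : ∑ i, ∑ j, ∑ r, T j r j * conj (T i r i) =
      ∑ r, (∑ i, T i i r) * conj (∑ i, T i i r) := by
    rw [sum_comm]
    exact trace_fst
  rw [norm_fst, norm_snd, trace_fst, trace_snd] at hsum
  have hzero : ∑ r, (∑ i, T i i r) * conj (∑ i, T i i r) = 0 := by
    linear_combination hsum / 2
  simp only [Complex.mul_conj] at hzero
  norm_cast at hzero
  intro k
  exact Complex.normSq_eq_zero.mp
    ((sum_eq_zero_iff_of_nonneg fun r _ => Complex.normSq_nonneg _).mp hzero k (mem_univ k))
end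

section
/- Let n ≥ 1 and let T^k_{ij} (1 ≤ i, j, k ≤ n) be complex numbers with T^k_{ij} = −T^k_{ji} for all i, j, k, satisfying ∑_{r=1}^n T^k_{ri}·T^r_{jl} = ∑_{r=1}^n T^k_{rj}·T^r_{il} for all indices i, j, k, l. For X ∈ ℂⁿ let A_X be the n×n complex matrix with entries (A_X)_{jk} = ∑_{i=1}^n X_i·T^k_{ij}. Then A_X·A_Y = −A_Y·A_X for all X, Y ∈ ℂⁿ; in particular (A_X)² = 0 for every X. -/
open Finset

/-- A trilinear array symmetric in its first two slots and antisymmetric in its last two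
vanishes; here the array is the iterated torsion `∑ r, T^k_{ri} T^r_{jl}`. -/
theorem iterated_torsion_eq_zero {ι R : Type*} [Fintype ι] [CommRing R] [NoZeroDivisors R]
    [CharZero R] (T : ι → ι → ι → R)
    (hanti : ∀ i j k, T k i j = -T k j i)
    (hsymm : ∀ i j k l, ∑ r, T k r i * T r j l = ∑ r, T k r j * T r i l) (i j k l : ι) :
    ∑ r, T k r i * T r j l = 0 := by
  have hswap (a b c : ι) : ∑ r, T k r a * T r b c = -∑ r, T k r a * T r c b := by
    rw [← sum_neg_distrib]
    exact sum_congr rfl fun r _ => by rw [hanti b c r, mul_neg]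
  rw [← self_eq_neg]
  calc ∑ r, T k r i * T r j l
      = -∑ r, T k r j * T r l i := by rw [hsymm i j k l, hswap j i l]
    _ = ∑ r, T k r l * T r i j := by rw [hsymm j l k i, hswap l j i, neg_neg]
    _ = -∑ r, T k r i * T r j l := by rw [hsymm l i k j, hswap i l j]

/-- The product of any two torsion operators vanishes. -/
theorem torsion_operators_mul_eq_zero {ι R : Type*} [Fintype ι] [CommRing R] [NoZeroDivisors R]
    [CharZero R] (T : ι → ι → ι → R)
    (hanti : ∀ i j k, T k i j = -T k j i)
    (hsymm : ∀ i j k l, ∑ r, T k r i * T r j l = ∑ r, T k r j * T r i l) (X Y : ι → R) :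
    (Matrix.of fun j k : ι => ∑ i, X i * T k i j) *
      (Matrix.of fun j k : ι => ∑ i, Y i * T k i j) = 0 := by
  ext j k
  simp only [Matrix.mul_apply, Matrix.of_apply, Matrix.zero_apply, sum_mul_sum]
  rw [sum_comm]
  refine sum_eq_zero fun i _ => ?_
  rw [sum_comm]
  refine sum_eq_zero fun p _ => ?_
  calc ∑ r, X i * T r i j * (Y p * T k p r)
      = -(X i * Y p) * ∑ r, T k r p * T r i j := by
        rw [mul_sum]
        exact sum_congr rfl fun r _ => by rw [hanti p r k]; ring
    _ = 0 := by rw [iterated_torsion_eq_zero T hanti hsymm, mul_zero]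

/-- Under identity (34) of the paper, the torsion operators `A_X`, with matrix
entries `(A_X)_{jk} = ∑_i X_i T^k_{ij}`, pairwise anti-commute; in particular each
`A_X` is step-2 nilpotent. -/
theorem torsion_operators_anticommute (n : ℕ) (hn : 1 ≤ n)
    (T : Fin n → Fin n → Fin n → ℂ)
    (hanti : ∀ i j k : Fin n, T k i j = -T k j i)
    (hmain : ∀ i j k l : Fin n,
      ∑ r, T k r i * T r j l = ∑ r, T k r j * T r i l) :
    ∀ X Y : Fin n → ℂ,
      (Matrix.of fun j k : Fin n => ∑ i, X i * T k i j) *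
          (Matrix.of fun j k : Fin n => ∑ i, Y i * T k i j) =
        -((Matrix.of fun j k : Fin n => ∑ i, Y i * T k i j) *
          (Matrix.of fun j k : Fin n => ∑ i, X i * T k i j)) ∧
      (Matrix.of fun j k : Fin n => ∑ i, X i * T k i j) *
          (Matrix.of fun j k : Fin n => ∑ i, X i * T k i j) = 0 := by
  have hmul := torsion_operators_mul_eq_zero T hanti hmain
  intro X Y
  exact ⟨by rw [hmul X Y, hmul Y X, neg_zero], hmul X X⟩
end

section
/- Let n ≥ 1 and let T^k_{ij} (1 ≤ i, j, k ≤ n) be complex numbers with T^k_{ij} = −T^k_{ji} for all i, j, k. Suppose that for all indices i, j, k, l both of the following hold: (a) 2·∑_{r=1}^n T^r_{ij}·conj(T^r_{kl}) = ∑_{r=1}^n ( T^l_{ri}·conj(T^j_{rk}) + T^k_{rj}·conj(T^i_{rl}) − T^k_{ri}·conj(T^j_{rl}) − T^l_{rj}·conj(T^i_{rk}) ), and (b) ∑_{r=1}^n T^k_{ri}·T^r_{jl} = ∑_{r=1}^n T^k_{rj}·T^r_{il}. Then T^k_{ij} = 0 for all i, j, k. -/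
open Finset
open scoped ComplexConjugate

/-- If the operators `T(·, e_i)` commute pairwise, an antisymmetric `T` is two-step nilpotent. -/
theorem sum_mul_eq_zero_of_antisymm_of_comm {ι : Type*} [Fintype ι] (T : ι → ι → ι → ℂ)
    (hanti : ∀ i j k, T k i j = -T k j i)
    (hb : ∀ i j k l, ∑ r, T k r i * T r j l = ∑ r, T k r j * T r i l) (i j k l : ι) :
    ∑ r, T k r i * T r j l = 0 := by
  have hneg : ∀ i j l, ∑ r, T k r i * T r j l = -∑ r, T k r i * T r l j := by
    intro i j l
    rw [← sum_neg_distrib]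
    exact sum_congr rfl fun r _ => by rw [hanti j l r, mul_neg]
  linear_combination (1 / 2 : ℂ) * (hb i j k l + hneg j i l - hb j l k i - hneg l j i
    + hb l i k j + hneg i l j)

/-- If `T` is two-step nilpotent and satisfies the torsion identity, then for a fixed bracket
`T(e_a, e_b)` its Hermitian pairing with every other bracket vanishes. -/
theorem sum_mul_conj_eq_zero_of_torsion_identity {ι : Type*} [Fintype ι] (T : ι → ι → ι → ℂ)
    (hanti : ∀ i j k, T k i j = -T k j i)
    (ha : ∀ i j k l,
      2 * ∑ r, T r i j * conj (T r k l) =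
        ∑ r, (T l r i * conj (T j r k) + T k r j * conj (T i r l)
          - T k r i * conj (T j r l) - T l r j * conj (T i r k)))
    (h0 : ∀ i j k l, ∑ r, T k r i * T r j l = 0) (a b s j : ι) :
    ∑ i, T i a b * conj (T i s j) = 0 := by
  have h0' : ∀ i j k l, ∑ r, T k i r * T r j l = 0 := by
    intro i j k l
    rw [← neg_eq_zero, ← sum_neg_distrib, ← h0 i j k l]
    exact sum_congr rfl fun r _ => by rw [hanti i r k, neg_mul, neg_neg]
  have hP : ∀ k l, ∑ r, (T k r j * ∑ i, T i a b * conj (T i r l)) =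
      ∑ r, (T l r j * ∑ i, T i a b * conj (T i r k)) := by
    intro k l
    have h := sum_congr (rfl : (univ : Finset ι) = univ)
      fun i _ => congrArg (fun z => z * T i a b) (ha i j k l)
    have e1 : ∑ i, (2 * ∑ r, T r i j * conj (T r k l)) * T i a b = 0 := by
      simp only [mul_sum, sum_mul]
      rw [sum_comm]
      refine sum_eq_zero fun r _ => ?_
      have := congrArg (fun z => 2 * conj (T r k l) * z) (h0 j a r b)
      simp only [mul_sum, mul_zero] at this
      rw [← this]
      exact sum_congr rfl fun i _ => by ring
    have e2 : ∀ l k, ∑ r, ∑ i, T l r i * conj (T j r k) * T i a b = 0 := by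
      intro l k
      refine sum_eq_zero fun r _ => ?_
      have := congrArg (fun z => conj (T j r k) * z) (h0' r a l b)
      simp only [mul_sum, mul_zero] at this
      rw [← this]
      exact sum_congr rfl fun i _ => by ring
    have e3 : ∀ k l, ∑ r, (T k r j * ∑ i, T i a b * conj (T i r l)) =
        ∑ r, ∑ i, T k r j * conj (T i r l) * T i a b := by
      intro k l
      simp only [mul_sum]
      exact sum_congr rfl fun r _ => sum_congr rfl fun i _ => by ring
    simp only [e1, sum_mul] at h
    rw [sum_comm] at h
    simp only [add_mul, sub_mul, sum_add_distrib, sum_sub_distrib, e2] at h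
    rw [e3, e3]
    linear_combination -h
  have hsum : ∑ r, (∑ i, T i a b * conj (T i r j)) * conj (∑ i, T i a b * conj (T i r j)) = 0 := by
    have h := sum_congr (rfl : (univ : Finset ι) = univ)
      fun k _ => congrArg (fun z => z * conj (T k a b)) (hP k j)
    have e1 : ∑ k, (∑ r, (T k r j * ∑ i, T i a b * conj (T i r j))) * conj (T k a b) =
        ∑ r, (∑ i, T i a b * conj (T i r j)) * conj (∑ i, T i a b * conj (T i r j)) := by
      rw [sum_congr rfl fun k _ => sum_mul .., sum_comm]
      refine sum_congr rfl fun r _ => ?_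
      rw [map_sum, mul_sum]
      refine sum_congr rfl fun k _ => ?_
      rw [map_mul, Complex.conj_conj]
      ring
    have e2 : ∑ k, (∑ r, (T j r j * ∑ i, T i a b * conj (T i r k))) * conj (T k a b) = 0 := by
      simp only [mul_sum, sum_mul]
      rw [sum_comm]
      refine sum_eq_zero fun r _ => ?_
      rw [sum_comm]
      refine sum_eq_zero fun i _ => ?_
      have := congrArg (fun z => T j r j * T i a b * conj z) (h0' r a i b)
      simp only [map_sum, map_mul, mul_sum, map_zero, mul_zero] at this
      rw [← this]
      exact sum_congr rfl fun k _ => by ring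
    rw [← e1, h, e2]
  simp only [Complex.mul_conj] at hsum
  rw [← Complex.ofReal_sum, Complex.ofReal_eq_zero,
    sum_eq_zero_iff_of_nonneg fun r _ => Complex.normSq_nonneg _] at hsum
  exact Complex.normSq_eq_zero.mp (hsum s (mem_univ s))

/-- If an array `T k i j` (modelling torsion coefficients `T^k_{ij}`), antisymmetric
in its lower indices, satisfies both identity (25) and identity (34) of the paper
(as the torsion of a compact Hermitian metric that is both Kähler-like and
G-Kähler-like does), then it vanishes identically. -/
theorem torsion_vanishes_of_kahler_like_and_G_kahler_like_compact (n : ℕ) (hn : 1 ≤ n)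
    (T : Fin n → Fin n → Fin n → ℂ)
    (hanti : ∀ i j k : Fin n, T k i j = -T k j i)
    (ha : ∀ i j k l : Fin n,
      2 * ∑ r, T r i j * conj (T r k l) =
        ∑ r, (T l r i * conj (T j r k) + T k r j * conj (T i r l)
          - T k r i * conj (T j r l) - T l r j * conj (T i r k)))
    (hb : ∀ i j k l : Fin n,
      ∑ r, T k r i * T r j l = ∑ r, T k r j * T r i l) :
    ∀ i j k : Fin n, T k i j = 0 := by
  intro i j k
  have h := sum_mul_conj_eq_zero_of_torsion_identity T hanti ha
    (sum_mul_eq_zero_of_antisymm_of_comm T hanti hb) i j i j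
  simp only [Complex.mul_conj] at h
  rw [← Complex.ofReal_sum, Complex.ofReal_eq_zero,
    sum_eq_zero_iff_of_nonneg fun r _ => Complex.normSq_nonneg _] at h
  exact Complex.normSq_eq_zero.mp (h k (mem_univ k))
end

section
/- Let E be a finite-dimensional real inner product space, n ≥ 1 an integer, and u : E → ℝ a smooth (C^∞) function. Set λ = e^{−u}. If λ(x)·Δλ(x) = n·‖∇λ(x)‖² for every x ∈ E, then the function e^{(n−1)u} is harmonic: Δ( e^{(n−1)u} )(x) = 0 for every x ∈ E. -/
open Finset Real

variable {E : Type*} [NormedAddCommGroup E] [InnerProductSpace ℝ E] [FiniteDimensional ℝ E]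

/-- The Laplacian of a function on a finite-dimensional real inner product space:
the sum of the second derivatives along an orthonormal basis. -/
noncomputable def laplacian (f : E → ℝ) (x : E) : ℝ :=
  ∑ i, fderiv ℝ (fun y => fderiv ℝ f y (stdOrthonormalBasis ℝ E i)) x
    (stdOrthonormalBasis ℝ E i)

theorem hasFDerivAt_exp_const_mul {F : Type*} [NormedAddCommGroup F] [NormedSpace ℝ F]
    {u : F → ℝ} {x : F} (hu : DifferentiableAt ℝ u x) (c : ℝ) :
    HasFDerivAt (fun y => Real.exp (c * u y)) ((Real.exp (c * u x) * c) • fderiv ℝ u x) x := by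
  rw [mul_smul]
  exact (hu.hasFDerivAt.const_mul c).exp

theorem sum_sq_fderiv_stdOrthonormalBasis (u : E → ℝ) (x : E) :
    ∑ i, fderiv ℝ u x (stdOrthonormalBasis ℝ E i) ^ 2 = ‖gradient u x‖ ^ 2 := by
  rw [← (stdOrthonormalBasis ℝ E).sum_sq_norm_inner_left (gradient u x)]
  refine Finset.sum_congr rfl fun i _ => ?_
  rw [gradient, InnerProductSpace.toDual_symm_apply, Real.norm_eq_abs, sq_abs]

theorem gradient_exp_const_mul {u : E → ℝ} {x : E} (hu : DifferentiableAt ℝ u x) (c : ℝ) :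
    gradient (fun y => Real.exp (c * u y)) x = (Real.exp (c * u x) * c) • gradient u x := by
  rw [gradient, (hasFDerivAt_exp_const_mul hu c).fderiv, gradient]
  simp

theorem laplacian_exp_const_mul {u : E → ℝ} (hu : ContDiff ℝ 2 u) (c : ℝ) (x : E) :
    laplacian (fun y => Real.exp (c * u y)) x =
      Real.exp (c * u x) * (c * laplacian u x + c ^ 2 * ‖gradient u x‖ ^ 2) := by
  have hd : Differentiable ℝ u := hu.differentiable (by norm_num)
  have hd' : Differentiable ℝ (fderiv ℝ u) :=
    (hu.fderiv_right (m := 1) (by norm_num)).differentiable (by norm_num)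
  rw [← sum_sq_fderiv_stdOrthonormalBasis, laplacian, laplacian, Finset.mul_sum, Finset.mul_sum,
    ← Finset.sum_add_distrib, Finset.mul_sum]
  refine Finset.sum_congr rfl fun i _ => ?_
  set v := stdOrthonormalBasis ℝ E i
  have hfirst : (fun y => fderiv ℝ (fun z => Real.exp (c * u z)) y v) =
      fun y => (Real.exp (c * u y) * c) * fderiv ℝ u y v := by
    ext y
    rw [(hasFDerivAt_exp_const_mul (hd y) c).fderiv]
    rfl
  have hv : DifferentiableAt ℝ (fun y => fderiv ℝ u y v) x :=
    (hd' x).clm_apply (differentiableAt_const v)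
  rw [hfirst, (((hasFDerivAt_exp_const_mul (hd x) c).mul_const c).fun_mul hv.hasFDerivAt).fderiv]
  simp only [add_apply, smul_apply, smul_eq_mul]
  ring

/-- If `λ = e^{-u}` satisfies `λ Δλ = n ‖∇λ‖²` everywhere, then `e^{(n-1)u}` is
harmonic (final assertion of Theorem 4 of the paper). -/
theorem harmonic_of_conformal_equation (n : ℕ) (hn : 1 ≤ n)
    (u : E → ℝ) (hu : ContDiff ℝ (⊤ : ℕ∞) u)
    (hlam : ∀ x : E,
      Real.exp (-u x) * laplacian (fun y => Real.exp (-u y)) x =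
        n * ‖gradient (fun y => Real.exp (-u y)) x‖ ^ 2) :
    ∀ x : E, laplacian (fun y => Real.exp (((n : ℝ) - 1) * u y)) x = 0 := by
  intro x
  have hu2 : ContDiff ℝ 2 u := contDiff_infty.1 hu 2
  have h := hlam x
  simp only [neg_eq_neg_one_mul (u _)] at h
  rw [laplacian_exp_const_mul hu2,
    gradient_exp_const_mul (hu2.differentiable (by norm_num) x), norm_smul, mul_pow,
    Real.norm_eq_abs, sq_abs] at h
  have hexp : Real.exp (-1 * u x) ^ 2 ≠ 0 := by positivity
  have hlap : laplacian u x = (1 - n) * ‖gradient u x‖ ^ 2 :=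
    mul_left_cancel₀ hexp (by linear_combination -h)
  rw [laplacian_exp_const_mul hu2, hlap]
  ring
end
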